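/- There do not exist a measurable space Λ with a probability measure μ and a family s assigning to each unit vector a in ℝ³ (EuclideanSpace ℝ (Fin 3)) a measurable function s(a) : Λ → ℝ taking values in {-1, 1}, such that for all unit vectors a and b one has ∫ s(a)(λ)·s(b)(λ) dμ(λ) = ⟪a, b⟫ (equivalently, such that the hidden-variable correlations P(a,b) = -∫ s(a)·s(b) dμ reproduce the quantum prediction -⟪a,b⟫ for every pair of directions). -/

import Mathlib

open MeasureTheory RealInnerProductSpace

/-- **Bell's inequality** for three `±1`-valued random variables on a probability space. -/
theorem bell_inequality {Ω : Type*} [MeasurableSpace Ω] (μ : Measure Ω) [IsProbabilityMeasure μ]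
    {f g h : Ω → ℝ} (hf : Measurable f) (hg : Measurable g) (hh : Measurable h)
    (hf' : ∀ x, f x = -1 ∨ f x = 1) (hg' : ∀ x, g x = -1 ∨ g x = 1)
    (hh' : ∀ x, h x = -1 ∨ h x = 1) :
    ∫ x, f x * h x ∂μ + ∫ x, g x * h x ∂μ - ∫ x, f x * g x ∂μ ≤ 1 := by
  have integrable_mul : ∀ {u v : Ω → ℝ}, Measurable u → Measurable v →
      (∀ x, u x = -1 ∨ u x = 1) → (∀ x, v x = -1 ∨ v x = 1) →
      Integrable (fun x => u x * v x) μ := by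
    intro u v hu hv hu' hv'
    refine Integrable.of_bound (hu.mul hv).aestronglyMeasurable 1 (.of_forall fun x => ?_)
    rcases hu' x with h1 | h1 <;> rcases hv' x with h2 | h2 <;> simp [h1, h2]
  have ifh := integrable_mul hf hh hf' hh'
  have igh := integrable_mul hg hh hg' hh'
  have ifg := integrable_mul hf hg hf' hg'
  have isum : Integrable (fun x => f x * h x + g x * h x) μ := ifh.add igh
  rw [← integral_add ifh igh, ← integral_sub isum ifg]
  calc ∫ x, (f x * h x + g x * h x - f x * g x) ∂μ
      ≤ ∫ _, (1 : ℝ) ∂μ := by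
        refine integral_mono (isum.sub ifg) (integrable_const 1) fun x => ?_
        rcases hf' x with h1 | h1 <;> rcases hg' x with h2 | h2 <;>
          rcases hh' x with h3 | h3 <;> norm_num [h1, h2, h3]
    _ = 1 := by simp

/-- No local hidden-variable model reproduces the quantum EPRB correlations: there
is no probability space (Λ, μ) and family of measurable ±1-valued outcome
functions s(a) : Λ → ℝ, one for each unit vector a in ℝ³, such that
∫ s(a)·s(b) dμ = ⟪a,b⟫ for all unit vectors a, b. -/
theorem no_hidden_variables_for_eprb :
    ¬ ∃ (Λ : Type) (_ : MeasurableSpace Λ) (μ : Measure Λ)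
        (_ : IsProbabilityMeasure μ)
        (s : EuclideanSpace ℝ (Fin 3) → Λ → ℝ),
      (∀ a : EuclideanSpace ℝ (Fin 3), ‖a‖ = 1 → Measurable (s a)) ∧
      (∀ a : EuclideanSpace ℝ (Fin 3), ‖a‖ = 1 →
        ∀ l, s a l = -1 ∨ s a l = 1) ∧
      (∀ a b : EuclideanSpace ℝ (Fin 3), ‖a‖ = 1 → ‖b‖ = 1 →
        ∫ l, s a l * s b l ∂μ = ⟪a, b⟫) := by
  rintro ⟨Λ, _, μ, _, s, hmeas, hval, hcorr⟩
  let a : EuclideanSpace ℝ (Fin 3) := !₂[1, 0, 0]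
  let b : EuclideanSpace ℝ (Fin 3) := !₂[0, 1, 0]
  let c : EuclideanSpace ℝ (Fin 3) := !₂[3 / 5, 4 / 5, 0]
  have ha : ‖a‖ = 1 := by simp [a, EuclideanSpace.norm_eq, Fin.sum_univ_three]
  have hb : ‖b‖ = 1 := by simp [b, EuclideanSpace.norm_eq, Fin.sum_univ_three]
  have hc : ‖c‖ = 1 := by
    simp [c, EuclideanSpace.norm_eq, Fin.sum_univ_three]
    norm_num
  have hac : ⟪a, c⟫ = 3 / 5 := by simp [a, c, PiLp.inner_apply, Fin.sum_univ_three]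
  have hbc : ⟪b, c⟫ = 4 / 5 := by simp [b, c, PiLp.inner_apply, Fin.sum_univ_three]
  have hab : ⟪a, b⟫ = 0 := by simp [a, b, PiLp.inner_apply, Fin.sum_univ_three]
  have bell := bell_inequality μ (hmeas a ha) (hmeas b hb) (hmeas c hc)
    (hval a ha) (hval b hb) (hval c hc)
  rw [hcorr a c ha hc, hcorr b c hb hc, hcorr a b ha hb, hac, hbc, hab] at bell
  norm_num at bell
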